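/- Intermediate step of Theorem 1 (Eq. trs2). Let k n : ℕ, θ φ : Fin k → ℝ, and Θ : ℝ. Define f : ℝ → Matrix (Fin 2) (Fin 2) ℂ by f(ε) := [θ₁(1+ε)]_{φ₁} · ⋯ · [θ_k(1+ε)]_{φ_k} · [θ_k(1+ε)]_{φ_k} · ⋯ · [θ₁(1+ε)]_{φ₁}, and suppose (fun ε => f(ε) − [Θ]_0) =O[𝓝 0] (fun ε => ε^(n+1)). Then for every real β, the function h(ε) := [θ₁(1+ε)]_{φ₁} · ⋯ · [θ_k(1+ε)]_{φ_k} · Z(β) · [θ_k(1+ε)]_{φ_k} · ⋯ · [θ₁(1+ε)]_{φ₁} satisfies (fun ε => h(ε) − [Θ/2]_0 · Z(β) · [Θ/2]_0) =O[𝓝 0] (fun ε => ε^(n+1)). -/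

import Mathlib

open Complex Matrix

noncomputable section

/-- The pulse `[θ]_φ = exp(-i(θ/2)(cos φ σx + sin φ σy))`. -/
def pulse (θ φ : ℝ) : Matrix (Fin 2) (Fin 2) ℂ :=
  !![(Real.cos (θ/2) : ℂ), -Complex.I * Complex.exp (-Complex.I * φ) * Real.sin (θ/2);
     -Complex.I * Complex.exp (Complex.I * φ) * Real.sin (θ/2), (Real.cos (θ/2) : ℂ)]

/-- The Z-rotation `Z(φ)`. -/
def Zrot (φ : ℝ) : Matrix (Fin 2) (Fin 2) ℂ :=
  !![Complex.exp (-Complex.I * φ / 2), 0; 0, Complex.exp (Complex.I * φ / 2)]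

/-- The Pauli matrix `σz`. -/
def σz : Matrix (Fin 2) (Fin 2) ℂ := !![1, 0; 0, -1]

attribute [local instance] Matrix.normedAddCommGroup Matrix.normedSpace

theorem pulse_mul_σz_mul_pulse (θ φ : ℝ) : pulse θ φ * σz * pulse θ φ = σz := by
  have hcs : (Real.cos (θ/2) : ℂ) ^ 2 + (Real.sin (θ/2) : ℂ) ^ 2 = 1 := by
    exact_mod_cast Real.cos_sq_add_sin_sq (θ/2)
  have hexp : Complex.exp (-Complex.I * φ) * Complex.exp (Complex.I * φ) = 1 := by
    rw [← Complex.exp_add]; simp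
  simp only [pulse, σz]
  generalize (Real.cos (θ/2) : ℂ) = c at *
  generalize (Real.sin (θ/2) : ℂ) = s at *
  generalize Complex.exp (-Complex.I * φ) = u at *
  generalize Complex.exp (Complex.I * φ) = v at *
  ext i j
  fin_cases i <;> fin_cases j <;> simp [Matrix.mul_apply, Fin.sum_univ_two]
  · linear_combination hcs + s ^ 2 * hexp - u * v * s ^ 2 * Complex.I_sq
  · ring
  · ring
  · linear_combination -hcs - s ^ 2 * hexp + u * v * s ^ 2 * Complex.I_sq

theorem pulse_half_mul_self (Θ : ℝ) : pulse (Θ / 2) 0 * pulse (Θ / 2) 0 = pulse Θ 0 := by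
  have hc : (Real.cos (Θ/2) : ℂ) = (Real.cos (Θ/2/2) : ℂ) ^ 2 - (Real.sin (Θ/2/2) : ℂ) ^ 2 := by
    have := Real.cos_two_mul' (Θ/2/2)
    rw [mul_div_cancel₀ (Θ/2) two_ne_zero] at this
    exact_mod_cast this
  have hs : (Real.sin (Θ/2) : ℂ) = 2 * (Real.sin (Θ/2/2) : ℂ) * (Real.cos (Θ/2/2) : ℂ) := by
    have := Real.sin_two_mul (Θ/2/2)
    rw [mul_div_cancel₀ (Θ/2) two_ne_zero] at this
    exact_mod_cast this
  simp only [pulse, hc, hs]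
  generalize (Real.cos (Θ/2/2) : ℂ) = c
  generalize (Real.sin (Θ/2/2) : ℂ) = s
  ext i j
  fin_cases i <;> fin_cases j <;> simp [Matrix.mul_apply, Fin.sum_univ_two]
  · linear_combination s ^ 2 * Complex.I_sq
  · ring
  · ring
  · linear_combination s ^ 2 * Complex.I_sq

theorem Zrot_eq (β : ℝ) :
    Zrot β = Complex.cos (β / 2) • (1 : Matrix (Fin 2) (Fin 2) ℂ)
      - (Complex.I * Complex.sin (β / 2)) • σz := by
  have h₁ : -Complex.I * (β : ℂ) / 2 = (-(β / 2 : ℂ)) * Complex.I := by ring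
  have h₂ : Complex.I * (β : ℂ) / 2 = (β / 2 : ℂ) * Complex.I := by ring
  simp only [Zrot, σz, h₁, h₂, Complex.exp_mul_I, Complex.cos_neg, Complex.sin_neg]
  ext i j
  fin_cases i <;> fin_cases j <;> simp <;> ring

/-- If every factor `M` satisfies `M * s * M = s`, so does a palindromic product around `s`. -/
theorem List.prod_mul_mul_reverse_prod {M : Type*} [Monoid M] {s : M} (l : List M)
    (hl : ∀ x ∈ l, x * s * x = s) : l.prod * s * l.reverse.prod = s := by
  induction l with
  | nil => simp
  | cons x l ih =>
    have hl' := ih fun y hy => hl y (List.mem_cons_of_mem x hy)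
    calc (x :: l).prod * s * (x :: l).reverse.prod
        = x * (l.prod * s * l.reverse.prod) * x := by simp [mul_assoc]
      _ = s := by rw [hl', hl x List.mem_cons_self]

theorem mul_Zrot_mul {A B : Matrix (Fin 2) (Fin 2) ℂ} (hAB : A * σz * B = σz) (β : ℝ) :
    A * Zrot β * B
      = Complex.cos (β / 2) • (A * B) - (Complex.I * Complex.sin (β / 2)) • σz := by
  rw [Zrot_eq, mul_sub, sub_mul, mul_smul_comm, mul_smul_comm, smul_mul_assoc, smul_mul_assoc,
    hAB, mul_one]

/-- Intermediate step of Theorem 1 (Eq. trs2): inserting `Z(β)` in the middle of a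
time-reversal symmetric robust sequence. -/
theorem Z_insertion_robustness
    (k n : ℕ) (θ φ : Fin k → ℝ) (Θ : ℝ)
    (h : (fun ε : ℝ =>
        (List.ofFn fun i => pulse (θ i * (1 + ε)) (φ i)).prod *
          (List.ofFn fun i => pulse (θ i * (1 + ε)) (φ i)).reverse.prod
          - pulse Θ 0) =O[nhds (0 : ℝ)] fun ε => ε ^ (n + 1)) :
    ∀ β : ℝ,
      (fun ε : ℝ =>
        (List.ofFn fun i => pulse (θ i * (1 + ε)) (φ i)).prod * Zrot β *
            (List.ofFn fun i => pulse (θ i * (1 + ε)) (φ i)).reverse.prod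
          - pulse (Θ / 2) 0 * Zrot β * pulse (Θ / 2) 0)
        =O[nhds (0 : ℝ)] fun ε => ε ^ (n + 1) := by
  intro β
  refine (h.const_smul_left (Complex.cos (β / 2))).congr_left fun ε => ?_
  have hl := List.prod_mul_mul_reverse_prod (s := σz)
    (List.ofFn fun i => pulse (θ i * (1 + ε)) (φ i)) (by
      simp only [List.forall_mem_ofFn_iff]
      exact fun i => pulse_mul_σz_mul_pulse _ _)
  rw [mul_Zrot_mul hl, mul_Zrot_mul (pulse_mul_σz_mul_pulse _ _), pulse_half_mul_self,
    sub_sub_sub_cancel_right, ← smul_sub, Pi.smul_apply]
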